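/- For fixed d ≥ 1, the Poissonized integral ι̂_{d,n} := n^d ∫_{[0,1)^d} (x_1⋯x_d)^{d-1} exp(-n x_1⋯x_d) dx satisfies, as n → ∞, ι̂_{d,n} = (ln n)^{d-1} Σ_{j=0}^{d-1} [(-1)^j Γ^{(j)}(d)/(j!(d-1-j)!)] (ln n)^{-j} + O((n ln n)^{d-1} e^{-n}), where Γ^{(j)} is the j-th derivative of the Gamma function. -/

import Mathlib

open MeasureTheory Filter Asymptotics Set

/-- Poissonized expected number of interior generators:
`ι̂_{d,n} = n^d ∫_{[0,1)^d} x_×^{d-1} e^{-n x_×} dx`. -/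
noncomputable def iotaHat (d n : ℕ) : ℝ :=
  (n : ℝ) ^ d *
    ∫ x in Set.univ.pi fun _ : Fin d => Set.Ico (0 : ℝ) 1,
      (∏ j, x j) ^ (d - 1) * Real.exp (-(n : ℝ) * ∏ j, x j)

/-- The measure `e^{-y} dy / y` on `(0, ∞)`. -/
noncomputable def gMeas : Measure ℝ :=
  (volume.restrict (Ioi (0 : ℝ))).withDensity (fun y => ENNReal.ofReal (Real.exp (-y) / y))

lemma gMeas_integrable (g : ℝ → ℝ) : Integrable g gMeas ↔
    IntegrableOn (fun y => Real.exp (-y) / y * g y) (Ioi 0) := by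
  rw [gMeas, integrable_withDensity_iff_integrable_smul' (by fun_prop)
    (ae_of_all _ fun _ => ENNReal.ofReal_lt_top)]
  apply integrable_congr
  filter_upwards [ae_restrict_mem measurableSet_Ioi] with y hy
  have hy : 0 < y := hy
  rw [ENNReal.toReal_ofReal (by positivity), smul_eq_mul]

lemma gMeas_integral (g : ℝ → ℝ) : ∫ y, g y ∂gMeas =
    ∫ y in Ioi 0, Real.exp (-y) / y * g y := by
  rw [gMeas, integral_withDensity_eq_integral_toReal_smul (by fun_prop)
    (ae_of_all _ fun _ => ENNReal.ofReal_lt_top)]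
  apply integral_congr_ae
  filter_upwards [ae_restrict_mem measurableSet_Ioi] with y hy
  have hy : 0 < y := hy
  rw [ENNReal.toReal_ofReal (by positivity), smul_eq_mul]

lemma gMeas_key {t y : ℝ} (hy : 0 < y) :
    Real.exp (-y) / y * Real.exp (t * Real.log y) = Real.exp (-y) * y ^ (t - 1) := by
  rw [Real.rpow_sub_one hy.ne', Real.rpow_def_of_pos hy, mul_comm t]
  ring

lemma gMeas_mem {t : ℝ} (ht : 0 < t) :
    t ∈ interior (ProbabilityTheory.integrableExpSet Real.log gMeas) := by
  refine mem_interior.2 ⟨Ioi 0, ?_, isOpen_Ioi, ht⟩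
  intro s hs
  show Integrable _ _
  rw [gMeas_integrable]
  refine (Real.GammaIntegral_convergent hs).congr_fun ?_ measurableSet_Ioi
  intro y hy
  exact (gMeas_key hy).symm

lemma gamma_eq_mgf {t : ℝ} (ht : 0 < t) :
    Real.Gamma t = ProbabilityTheory.mgf Real.log gMeas t := by
  rw [Real.Gamma_eq_integral ht, ProbabilityTheory.mgf, gMeas_integral]
  refine setIntegral_congr_fun measurableSet_Ioi ?_
  intro y hy
  exact (gMeas_key hy).symm

lemma gMeas_key2 {m j : ℕ} {y : ℝ} (hy : 0 < y) :
    Real.exp (-y) / y * (Real.log y ^ j * Real.exp (((m + 1 : ℕ) : ℝ) * Real.log y)) =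
      y ^ m * Real.exp (-y) * Real.log y ^ j := by
  have := gMeas_key (t := ((m + 1 : ℕ) : ℝ)) hy
  rw [show ((m + 1 : ℕ) : ℝ) - 1 = (m : ℝ) by push_cast; ring, Real.rpow_natCast] at this
  linear_combination Real.log y ^ j * this

lemma gamma_deriv (m j : ℕ) : iteratedDeriv j Real.Gamma ((m + 1 : ℕ) : ℝ) =
    ∫ y in Ioi 0, y ^ m * Real.exp (-y) * Real.log y ^ j := by
  have hpos : (0 : ℝ) < ((m + 1 : ℕ) : ℝ) := by positivity
  have : Real.Gamma =ᶠ[nhds ((m + 1 : ℕ) : ℝ)] ProbabilityTheory.mgf Real.log gMeas := by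
    filter_upwards [Ioi_mem_nhds hpos] with t ht
    exact gamma_eq_mgf ht
  rw [this.iteratedDeriv_eq, ProbabilityTheory.iteratedDeriv_mgf (gMeas_mem hpos), gMeas_integral]
  refine setIntegral_congr_fun measurableSet_Ioi ?_
  intro y hy
  exact gMeas_key2 hy

lemma gamma_int (m j : ℕ) :
    IntegrableOn (fun y => y ^ m * Real.exp (-y) * Real.log y ^ j) (Ioi (0 : ℝ)) := by
  have hpos : (0 : ℝ) < ((m + 1 : ℕ) : ℝ) := by positivity
  have := ProbabilityTheory.integrable_pow_mul_exp_of_mem_interior_integrableExpSet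
    (gMeas_mem hpos) j
  rw [gMeas_integrable] at this
  refine this.congr_fun ?_ measurableSet_Ioi
  intro y hy
  exact gMeas_key2 hy

lemma inner_int (d : ℕ) {z : ℝ} (hz : z ∈ Ioo (0 : ℝ) 1) :
    ∫⁻ x in Ioo z 1, ENNReal.ofReal ((-Real.log (z / x)) ^ d / d.factorial * x⁻¹) =
      ENNReal.ofReal ((-Real.log z) ^ (d + 1) / (d + 1).factorial) := by
  obtain ⟨hz0, hz1⟩ := hz
  have hne : ∀ x ∈ Icc z 1, x ≠ 0 := fun x hx => (hz0.trans_le hx.1).ne'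
  have hcont : ContinuousOn (fun x => (Real.log x - Real.log z) ^ d / d.factorial * x⁻¹)
      (Icc z 1) := by
    refine ContinuousOn.mul ?_ (continuousOn_inv₀.mono fun x hx => hne x hx)
    refine ContinuousOn.div_const (ContinuousOn.pow (ContinuousOn.sub ?_ continuousOn_const) _) _
    exact Real.continuousOn_log.mono fun x hx => hne x hx
  have h1 : ∫⁻ x in Ioo z 1, ENNReal.ofReal ((-Real.log (z / x)) ^ d / d.factorial * x⁻¹) =
      ∫⁻ x in Ioo z 1, ENNReal.ofReal ((Real.log x - Real.log z) ^ d / d.factorial * x⁻¹) := by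
    refine setLIntegral_congr_fun measurableSet_Ioo fun x hx => ?_
    have hx0 : 0 < x := hz0.trans hx.1
    beta_reduce
    rw [Real.log_div hz0.ne' hx0.ne', neg_sub]
  rw [h1, ← ofReal_integral_eq_lintegral_ofReal]
  · congr 1
    rw [← integral_Ioc_eq_integral_Ioo, ← intervalIntegral.integral_of_le hz1.le]
    have hder : ∀ x ∈ uIcc z 1, HasDerivAt
        (fun x => (Real.log x - Real.log z) ^ (d + 1) / (d + 1).factorial)
        ((Real.log x - Real.log z) ^ d / d.factorial * x⁻¹) x := by
      intro x hx
      rw [uIcc_of_le hz1.le] at hx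
      have := (((Real.hasDerivAt_log (hne x hx)).sub_const (Real.log z)).pow (d + 1)).div_const
        ((d + 1).factorial : ℝ)
      refine this.congr_deriv ?_
      have hf : (d.factorial : ℝ) ≠ 0 := by positivity
      have hd' : (d : ℝ) + 1 ≠ 0 := by positivity
      rw [Nat.factorial_succ]
      push_cast
      field_simp
    rw [intervalIntegral.integral_eq_sub_of_hasDerivAt hder]
    · simp
    · apply ContinuousOn.intervalIntegrable
      rwa [uIcc_of_le hz1.le]
  · exact (hcont.integrableOn_Icc).mono_set Ioo_subset_Icc_self
  · filter_upwards [ae_restrict_mem measurableSet_Ioo] with x hx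
    have hx0 : 0 < x := hz0.trans hx.1
    have : 0 ≤ Real.log x - Real.log z := sub_nonneg.2 (Real.log_le_log hz0 hx.1.le)
    simp only [Pi.zero_apply]
    positivity

lemma step_int (d : ℕ) (f : ℝ → ENNReal) (hf : Measurable f) :
    ∫⁻ x in Ioo (0 : ℝ) 1, ∫⁻ w in Ioo (0 : ℝ) 1,
      f (x * w) * ENNReal.ofReal ((-Real.log w) ^ d / d.factorial) =
    ∫⁻ z in Ioo (0 : ℝ) 1, f z * ENNReal.ofReal ((-Real.log z) ^ (d + 1) / (d + 1).factorial) := by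
  set K : ℝ → ℝ → ENNReal := fun x z => if z < x then
    f z * ENNReal.ofReal ((-Real.log (z / x)) ^ d / d.factorial * x⁻¹) else 0 with hK
  have hKm : Measurable (Function.uncurry K) := by
    refine Measurable.ite (measurableSet_lt measurable_snd measurable_fst) ?_ measurable_const
    fun_prop
  have hA : ∀ x ∈ Ioo (0 : ℝ) 1, ∫⁻ w in Ioo (0 : ℝ) 1,
      f (x * w) * ENNReal.ofReal ((-Real.log w) ^ d / d.factorial) =
      ∫⁻ z in Ioo (0 : ℝ) 1, K x z := by
    intro x hx
    have him : (fun w => x * w) '' Ioo (0 : ℝ) 1 = Ioo 0 x := by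
      rw [Set.image_mul_left_Ioo hx.1]; simp
    have h2 : ∫⁻ z in Ioo (0 : ℝ) 1, K x z = ∫⁻ z in Ioo (0 : ℝ) x,
        f z * ENNReal.ofReal ((-Real.log (z / x)) ^ d / d.factorial * x⁻¹) := by
      rw [← lintegral_indicator measurableSet_Ioo, ← lintegral_indicator measurableSet_Ioo]
      congr 1
      ext z
      simp only [Set.indicator, mem_Ioo, hK]
      have := hx.2
      by_cases h0 : 0 < z <;> by_cases h1 : z < x <;> simp [h0, h1]
      intro h; linarith
    rw [h2, ← him, lintegral_image_eq_lintegral_abs_deriv_mul measurableSet_Ioo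
      (f' := fun _ => x) (fun w _ => by
        simpa using ((hasDerivAt_id w).const_mul x).hasDerivWithinAt)
      ((mul_right_injective₀ hx.1.ne').injOn)]
    refine setLIntegral_congr_fun measurableSet_Ioo fun w hw => ?_
    beta_reduce
    rw [mul_div_cancel_left₀ _ hx.1.ne', mul_left_comm, ← ENNReal.ofReal_mul (abs_nonneg _),
      abs_of_pos hx.1]
    congr 2
    field_simp [hx.1.ne']
  rw [setLIntegral_congr_fun measurableSet_Ioo hA, lintegral_lintegral_swap hKm.aemeasurable]
  refine setLIntegral_congr_fun measurableSet_Ioo fun z hz => ?_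
  beta_reduce
  rw [← inner_int d hz, ← lintegral_const_mul _ (by fun_prop),
    ← lintegral_indicator measurableSet_Ioo, ← lintegral_indicator measurableSet_Ioo]
  congr 1
  ext x
  simp only [Set.indicator, mem_Ioo, hK]
  have := hz.1
  by_cases h0 : z < x <;> by_cases h1 : x < 1 <;> simp [h0, h1]
  intro h; linarith

lemma cube_lintegral (d : ℕ) : ∀ f : ℝ → ENNReal, Measurable f →
    ∫⁻ x, f (∏ j, x j) ∂(Measure.pi fun _ : Fin (d + 1) => volume.restrict (Ioo (0 : ℝ) 1)) =
    ∫⁻ z in Ioo (0 : ℝ) 1, f z * ENNReal.ofReal ((-Real.log z) ^ d / d.factorial) := by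
  induction d with
  | zero =>
    intro f hf
    have := (measurePreserving_funUnique (volume.restrict (Ioo (0 : ℝ) 1)) (Fin 1)).lintegral_comp hf
    simp only [MeasurableEquiv.funUnique_apply] at this
    simp
    convert this using 1
    congr!
  | succ d ih =>
    intro f hf
    rw [← step_int d f hf]
    have hmp := measurePreserving_piFinSuccAbove
      (fun _ : Fin (d + 1 + 1) => volume.restrict (Ioo (0 : ℝ) 1)) 0
    have h := hmp.lintegral_comp
      (f := fun p : ℝ × (Fin (d + 1) → ℝ) => f (p.1 * ∏ j, p.2 j)) (by fun_prop)
    have e : ∀ x : Fin (d + 1 + 1) → ℝ, ∏ j, x j =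
      (MeasurableEquiv.piFinSuccAbove (fun _ => ℝ) 0 x).1 *
        ∏ j, (MeasurableEquiv.piFinSuccAbove (fun _ => ℝ) 0 x).2 j := by
      intro x
      rw [Fin.prod_univ_succ]
      rfl
    simp_rw [e]
    rw [h, lintegral_prod _ (by fun_prop)]
    refine lintegral_congr fun x => ?_
    exact ih (fun w => f (x * w)) (by fun_prop)

lemma cube_integral (m : ℕ) (n : ℝ) :
    ∫ x in Set.univ.pi fun _ : Fin (m + 1) => Set.Ico (0 : ℝ) 1,
      (∏ j, x j) ^ m * Real.exp (-n * ∏ j, x j) =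
    ∫ z in Ioo (0 : ℝ) 1, z ^ m * Real.exp (-n * z) * ((-Real.log z) ^ m / m.factorial) := by
  have hmeas : (volume : Measure (Fin (m + 1) → ℝ)).restrict
      (Set.univ.pi fun _ : Fin (m + 1) => Set.Ico (0 : ℝ) 1) =
      Measure.pi fun _ : Fin (m + 1) => volume.restrict (Ioo (0 : ℝ) 1) := by
    rw [volume_pi, Measure.restrict_pi_pi]
    congr 1
    ext1 i
    exact Measure.restrict_congr_set Ioo_ae_eq_Ico.symm
  have hnn : 0 ≤ᵐ[volume.restrict (Set.univ.pi fun _ : Fin (m + 1) => Set.Ico (0 : ℝ) 1)]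
      fun x => (∏ j, x j) ^ m * Real.exp (-n * ∏ j, x j) := by
    filter_upwards [ae_restrict_mem (MeasurableSet.univ_pi fun _ => measurableSet_Ico)] with x hx
    have : 0 ≤ ∏ j, x j := Finset.prod_nonneg fun j _ => (hx j (mem_univ _)).1
    simp only [Pi.zero_apply]
    positivity
  rw [integral_eq_lintegral_of_nonneg_ae hnn (by fun_prop), hmeas,
    cube_lintegral m (fun z => ENNReal.ofReal (z ^ m * Real.exp (-n * z))) (by fun_prop),
    integral_eq_lintegral_of_nonneg_ae]
  · congr 1
    refine setLIntegral_congr_fun measurableSet_Ioo fun z hz => ?_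
    have := hz.1
    beta_reduce
    exact (ENNReal.ofReal_mul (by positivity)).symm
  · filter_upwards [ae_restrict_mem measurableSet_Ioo] with z hz
    have := hz.1
    have : 0 ≤ -Real.log z := neg_nonneg.2 (Real.log_nonpos hz.1.le hz.2.le)
    simp only [Pi.zero_apply]
    positivity
  · exact Measurable.aestronglyMeasurable (by fun_prop)

/-- The integrand after scaling. -/
noncomputable def hFun (m : ℕ) (L y : ℝ) : ℝ :=
  y ^ m * Real.exp (-y) * ((L - Real.log y) ^ m / m.factorial)

lemma hFun_expand (m : ℕ) (L y : ℝ) : hFun m L y = ∑ j ∈ Finset.range (m + 1),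
    ((-1 : ℝ) ^ j * L ^ (m - j) / ((j.factorial : ℝ) * ((m - j).factorial : ℝ))) *
      (y ^ m * Real.exp (-y) * Real.log y ^ j) := by
  rw [hFun, show L - Real.log y = -Real.log y + L by ring, add_pow, Finset.sum_div, Finset.mul_sum]
  refine Finset.sum_congr rfl fun j hj => ?_
  have hj' : j ≤ m := by simpa [Nat.lt_succ_iff] using hj
  have hc : ((m.choose j : ℕ) : ℝ) = m.factorial / (j.factorial * (m - j).factorial) :=
    Nat.cast_choose ℝ hj'
  have h1 : (m.factorial : ℝ) ≠ 0 := by positivity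
  have h2 : (j.factorial : ℝ) ≠ 0 := by positivity
  have h3 : ((m - j).factorial : ℝ) ≠ 0 := by positivity
  rw [hc, neg_pow]
  field_simp

lemma hFun_int (m : ℕ) (L : ℝ) : IntegrableOn (hFun m L) (Ioi 0) := by
  have : hFun m L = fun y => ∑ j ∈ Finset.range (m + 1),
    ((-1 : ℝ) ^ j * L ^ (m - j) / ((j.factorial : ℝ) * ((m - j).factorial : ℝ))) *
      (y ^ m * Real.exp (-y) * Real.log y ^ j) := by
    ext y; exact hFun_expand m L y
  rw [this]
  exact integrable_finsetSum _ fun j _ => (gamma_int m j).const_mul _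

lemma hFun_integral (m : ℕ) {L : ℝ} (hL : L ≠ 0) : ∫ y in Ioi 0, hFun m L y =
    L ^ m * ∑ j ∈ Finset.range (m + 1),
      (-1 : ℝ) ^ j * iteratedDeriv j Real.Gamma ((m + 1 : ℕ) : ℝ) /
        ((j.factorial : ℝ) * ((m - j).factorial : ℝ)) * (L⁻¹) ^ j := by
  simp_rw [hFun_expand]
  rw [integral_finsetSum _ fun j _ => (gamma_int m j).const_mul _, Finset.mul_sum]
  refine Finset.sum_congr rfl fun j hj => ?_
  have hj' : j ≤ m := by simpa [Nat.lt_succ_iff] using hj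
  rw [integral_const_mul, gamma_deriv, ← Nat.sub_add_cancel hj', pow_add L (m - j) j,
    Nat.sub_add_cancel hj', inv_pow]
  field_simp

lemma iotaHat_eq (m n : ℕ) (hn : 1 ≤ n) :
    iotaHat (m + 1) n = ∫ y in Ioo (0 : ℝ) n, hFun m (Real.log n) y := by
  have hn0 : (0 : ℝ) < n := by exact_mod_cast hn
  have him : (fun w => (n : ℝ) * w) '' Ioo (0 : ℝ) 1 = Ioo 0 (n : ℝ) := by
    rw [Set.image_mul_left_Ioo hn0]; simp
  rw [iotaHat]
  simp only [Nat.add_sub_cancel]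
  rw [cube_integral, ← him, integral_image_eq_integral_abs_deriv_smul measurableSet_Ioo
      (f' := fun _ => (n : ℝ)) (fun w _ => by
        simpa using ((hasDerivAt_id w).const_mul (n : ℝ)).hasDerivWithinAt)
      ((mul_right_injective₀ hn0.ne').injOn), ← integral_const_mul]
  refine setIntegral_congr_fun measurableSet_Ioo fun z hz => ?_
  simp only [hFun, smul_eq_mul, abs_of_pos hn0]
  rw [Real.log_mul hn0.ne' hz.1.ne', mul_pow, neg_mul]
  ring

lemma hFun_bound (m : ℕ) {n y : ℝ} (hn : 1 ≤ n) (hy : n < y) :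
    ‖hFun m (Real.log n) y‖ ≤
      (4 ^ m * (2 * m).factorial * Real.exp (1 / 2) * Real.exp (-n / 2)) * Real.exp (-(1 / 2) * y) := by
  have hn0 : 0 < n := by linarith
  have hy0 : 0 < y := by linarith
  set t := y - n with ht
  have ht0 : 0 < t := by linarith
  have hlog0 : 0 ≤ Real.log y - Real.log n := sub_nonneg.2 (Real.log_le_log hn0 hy.le)
  have hlog : Real.log y - Real.log n ≤ t / n := by
    rw [← Real.log_div hy0.ne' hn0.ne']
    refine (Real.log_le_sub_one_of_pos (by positivity)).trans (le_of_eq ?_)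
    rw [ht]; field_simp
  have habs : ‖hFun m (Real.log n) y‖ =
      (y * (Real.log y - Real.log n)) ^ m * Real.exp (-y) / m.factorial := by
    rw [hFun, norm_mul, norm_mul, norm_div, norm_pow, norm_pow, Real.norm_eq_abs, Real.norm_eq_abs,
      Real.norm_eq_abs, Real.norm_eq_abs, abs_sub_comm, abs_of_pos hy0, abs_of_nonneg hlog0,
      abs_of_pos (Real.exp_pos _), abs_of_pos (by positivity), mul_pow]
    ring
  have h1 : y * (Real.log y - Real.log n) ≤ (1 + t) ^ 2 := by
    calc y * (Real.log y - Real.log n) ≤ y * (t / n) := by gcongr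
      _ = t + t ^ 2 / n := by
        rw [show y = n + t by rw [ht]; ring]; field_simp
      _ ≤ t + t ^ 2 := by
        gcongr
        exact div_le_self (by positivity) hn
      _ ≤ (1 + t) ^ 2 := by nlinarith
  have h2 : ((1 + t) ^ 2) ^ m ≤ 4 ^ m * (2 * m).factorial * Real.exp ((1 + t) / 2) := by
    have := Real.pow_div_factorial_le_exp ((1 + t) / 2) (by positivity) (2 * m)
    rw [div_le_iff₀ (by positivity), div_pow, div_le_iff₀ (by positivity), pow_mul, pow_mul] at this
    norm_num at this
    linarith
  rw [habs]
  calc (y * (Real.log y - Real.log n)) ^ m * Real.exp (-y) / m.factorial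
      ≤ (y * (Real.log y - Real.log n)) ^ m * Real.exp (-y) := by
        apply div_le_self (by positivity)
        exact_mod_cast Nat.one_le_iff_ne_zero.2 (Nat.factorial_ne_zero m)
    _ ≤ ((1 + t) ^ 2) ^ m * Real.exp (-y) := by gcongr
    _ ≤ (4 ^ m * (2 * m).factorial * Real.exp ((1 + t) / 2)) * Real.exp (-y) := by gcongr
    _ = _ := by
      have : Real.exp ((1 + t) / 2) * Real.exp (-y) =
        Real.exp (1 / 2) * Real.exp (-n / 2) * Real.exp (-(1 / 2) * y) := by
        rw [← Real.exp_add, ← Real.exp_add, ← Real.exp_add]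
        congr 1
        rw [ht]; ring
      linear_combination (4 ^ m * ((2 * m).factorial : ℝ)) * this

theorem stmt11 (d : ℕ) (hd : 1 ≤ d) :
    (fun n : ℕ =>
        iotaHat d n -
          (Real.log n) ^ (d - 1) *
            ∑ j ∈ Finset.range d,
              (-1 : ℝ) ^ j * iteratedDeriv j Real.Gamma (d : ℝ) /
                  ((j.factorial : ℝ) * ((d - 1 - j).factorial : ℝ)) *
                ((Real.log n)⁻¹) ^ j)
      =O[atTop] fun n : ℕ => ((n : ℝ) * Real.log n) ^ (d - 1) * Real.exp (-(n : ℝ)) := by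
  obtain ⟨m, rfl⟩ : ∃ m, d = m + 1 := ⟨d - 1, by omega⟩
  simp only [Nat.add_sub_cancel]
  refine IsBigO.of_bound (2 * (4 ^ m * (2 * m).factorial * Real.exp (1 / 2))) ?_
  filter_upwards [eventually_ge_atTop 3] with n hn
  have hn3 : (3 : ℝ) ≤ n := by exact_mod_cast hn
  have hn0 : (0 : ℝ) < n := by linarith
  have hlog : 1 ≤ Real.log n := by
    rw [Real.le_log_iff_exp_le hn0]
    linarith [Real.exp_one_lt_d9]
  rw [← hFun_integral m (by linarith), iotaHat_eq m n (by omega)]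
  have hsplit : ∫ y in Ioi 0, hFun m (Real.log n) y =
      (∫ y in Ioo (0 : ℝ) n, hFun m (Real.log n) y) + ∫ y in Ioi (n : ℝ), hFun m (Real.log n) y := by
    rw [← integral_Ioc_eq_integral_Ioo, ← setIntegral_union Ioc_disjoint_Ioi_same measurableSet_Ioi
      ((hFun_int m _).mono_set Ioc_subset_Ioi_self)
      ((hFun_int m _).mono_set (Ioi_subset_Ioi hn0.le)), Ioc_union_Ioi_eq_Ioi hn0.le]
  rw [hsplit, sub_add_cancel_left, norm_neg]
  set C : ℝ := 4 ^ m * (2 * m).factorial * Real.exp (1 / 2) with hC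
  have hb : ‖∫ y in Ioi (n : ℝ), hFun m (Real.log n) y‖ ≤
      ∫ y in Ioi (n : ℝ), (C * Real.exp (-n / 2)) * Real.exp (-(1 / 2) * y) := by
    refine norm_integral_le_of_norm_le
      ((integrableOn_exp_mul_Ioi (by norm_num) _).const_mul _) ?_
    filter_upwards [ae_restrict_mem measurableSet_Ioi] with y hy
    exact hFun_bound m (by linarith) hy
  rw [integral_const_mul, integral_exp_mul_Ioi (by norm_num)] at hb
  refine hb.trans ?_
  have he : Real.exp (-n / 2) * Real.exp (-(1 / 2) * n) = Real.exp (-(n : ℝ)) := by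
    rw [← Real.exp_add]; congr 1; ring
  have h1 : C * Real.exp (-n / 2) * (-Real.exp (-(1 / 2) * n) / -(1 / 2)) =
      2 * C * (1 * Real.exp (-(n : ℝ))) := by
    rw [← he]; ring
  have hp : 1 ≤ ((n : ℝ) * Real.log n) ^ m := one_le_pow₀ (by nlinarith)
  rw [h1, Real.norm_of_nonneg (by positivity)]
  gcongr
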